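/- The total degree of det A, as a polynomial in ℂ[x₀,…,x_{t−1}], is at most t(t−1)a²/2. -/

import Mathlib

open Finset

/-- Binomial polynomial `C(y,n) = y(y−1)⋯(y−n+1)/n!` for `n ≥ 0`, and `0` for `n < 0`. -/
noncomputable def polyBinom (t : ℕ) (y : MvPolynomial (Fin t) ℂ) (n : ℤ) :
    MvPolynomial (Fin t) ℂ :=
  if 0 ≤ n then
    ((n.toNat.factorial : ℂ)⁻¹) • ∏ j ∈ Finset.range n.toNat, (y - (j : MvPolynomial (Fin t) ℂ))
  else 0

/-- `α_i^k(x_s) = Σ_{j=1}^{k} C(x_s, i+j)·C(−x_s, k−j)`. -/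
noncomputable def alphaP (t : ℕ) (s : Fin t) (k : ℕ) (i : ℤ) : MvPolynomial (Fin t) ℂ :=
  ∑ j ∈ Finset.Icc 1 k,
    polyBinom t (MvPolynomial.X s) (i + j) * polyBinom t (-(MvPolynomial.X s)) ((k : ℤ) - j)

/-- The `(at)×(at)` matrix `A = (A₀ ⋯ A_{t−1})`: rows and columns are indexed by
`Fin t × Fin a` via the bijection `(v,w) ↦ v·a + w + 1` (1-based); the entry in global row
`u = v·a + w + 1` and column `(s, k)` (block `s`, inner column `k+1`) is
`α^{k+1}_{(t−1)a−u}(x_s)`. -/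
noncomputable def matA (t a : ℕ) :
    Matrix (Fin t × Fin a) (Fin t × Fin a) (MvPolynomial (Fin t) ℂ) :=
  Matrix.of fun u c =>
    alphaP t c.1 (c.2.val + 1) (((t : ℤ) - 1) * a - ((u.1.val : ℤ) * a + u.2.val + 1))

theorem MvPolynomial.totalDegree_prod_linear_le {σ R ι : Type*} [CommRing R]
    (s : Finset ι) (f : ι → MvPolynomial σ R) (hf : ∀ i ∈ s, (f i).totalDegree ≤ 1) :
    (∏ i ∈ s, f i).totalDegree ≤ s.card := by
  refine (MvPolynomial.totalDegree_finsetProd s f).trans ?_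
  simpa using Finset.sum_le_sum hf

theorem polyBinom_of_neg (t : ℕ) (y : MvPolynomial (Fin t) ℂ) {n : ℤ} (hn : n < 0) :
    polyBinom t y n = 0 :=
  if_neg (not_le.2 hn)

/-- The binomial polynomial of a linear form has total degree at most `n`. -/
theorem totalDegree_polyBinom_le (t : ℕ) (y : MvPolynomial (Fin t) ℂ) (hy : y.totalDegree ≤ 1)
    (n : ℤ) : (polyBinom t y n).totalDegree ≤ n.toNat := by
  unfold polyBinom
  split_ifs
  · refine (MvPolynomial.totalDegree_smul_le _ _).trans ?_
    refine (MvPolynomial.totalDegree_prod_linear_le _ _ fun j _ => ?_).trans_eq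
      (Finset.card_range _)
    refine (MvPolynomial.totalDegree_sub _ _).trans (max_le hy ?_)
    rw [← map_natCast (MvPolynomial.C : ℂ →+* MvPolynomial (Fin t) ℂ) j,
      MvPolynomial.totalDegree_C]
    exact Nat.zero_le _
  · simp

theorem alphaP_of_neg (t : ℕ) (s : Fin t) (k : ℕ) {i : ℤ} (h : i + k < 0) :
    alphaP t s k i = 0 := by
  refine Finset.sum_eq_zero fun j hj => ?_
  have hjk := (Finset.mem_Icc.1 hj).2
  rw [polyBinom_of_neg t _ (by omega), zero_mul]

theorem totalDegree_alphaP_le (t : ℕ) (s : Fin t) (k : ℕ) (i : ℤ) :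
    (alphaP t s k i).totalDegree ≤ (i + k).toNat := by
  refine MvPolynomial.totalDegree_finsetSum_le fun j hj => ?_
  have hjk := (Finset.mem_Icc.1 hj).2
  rcases lt_or_ge (i + j) 0 with h | h
  · rw [polyBinom_of_neg t _ h, zero_mul, MvPolynomial.totalDegree_zero]
    exact Nat.zero_le _
  · refine (MvPolynomial.totalDegree_mul _ _).trans ?_
    have h1 := totalDegree_polyBinom_le t (MvPolynomial.X s)
      (MvPolynomial.totalDegree_X s).le (i + j)
    have h2 := totalDegree_polyBinom_le t (-(MvPolynomial.X s))
      (by rw [MvPolynomial.totalDegree_neg, MvPolynomial.totalDegree_X]) ((k : ℤ) - j)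
    omega

/-- If every nonzero entry `M i j` has total degree at most `r i + c j`, then `det M` has total
degree at most `∑ r + ∑ c`. -/
theorem Matrix.totalDegree_det_le {σ R n : Type*} [CommRing R] [Fintype n] [DecidableEq n]
    (M : Matrix n n (MvPolynomial σ R)) (r c : n → ℤ) (D : ℕ)
    (hM : ∀ i j, M i j = 0 ∨ ((M i j).totalDegree : ℤ) ≤ r i + c j)
    (hD : ∑ i, r i + ∑ i, c i ≤ D) : M.det.totalDegree ≤ D := by
  rw [Matrix.det_apply]
  refine MvPolynomial.totalDegree_finsetSum_le fun τ _ => ?_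
  have key : (∏ i, M (τ i) i).totalDegree ≤ D := by
    by_cases h : ∃ i, M (τ i) i = 0
    · obtain ⟨i, hi⟩ := h
      have hprod : ∏ j, M (τ j) j = 0 := Finset.prod_eq_zero (Finset.mem_univ i) hi
      rw [hprod, MvPolynomial.totalDegree_zero]
      exact Nat.zero_le _
    · refine (MvPolynomial.totalDegree_finsetProd _ _).trans ?_
      zify
      calc ∑ i, ((M (τ i) i).totalDegree : ℤ) ≤ ∑ i, (r (τ i) + c i) :=
            Finset.sum_le_sum fun i _ => (hM (τ i) i).resolve_left fun h0 => h ⟨i, h0⟩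
        _ = ∑ i, r i + ∑ i, c i := by rw [Finset.sum_add_distrib, Equiv.sum_comp τ r]
        _ ≤ D := hD
  rcases Int.units_eq_one_or (Equiv.Perm.sign τ) with h | h
  · rwa [h, one_smul]
  · rwa [h, Units.neg_smul, one_smul, MvPolynomial.totalDegree_neg]

theorem stmt19 (t a : ℕ) (ht : 0 < t) (ha : 0 < a) :
    (matA t a).det.totalDegree ≤ t * (t - 1) * a ^ 2 / 2 := by
  refine Matrix.totalDegree_det_le _
    (fun u => ((t : ℤ) - 1) * a - ((u.1.val : ℤ) * a + u.2.val + 1))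
    (fun c => (c.2.val : ℤ) + 1) _ (fun u c => ?_) ?_
  · have hle := totalDegree_alphaP_le t c.1 (c.2.val + 1)
      (((t : ℤ) - 1) * a - ((u.1.val : ℤ) * a + u.2.val + 1))
    rcases lt_or_ge ((((t : ℤ) - 1) * a - ((u.1.val : ℤ) * a + u.2.val + 1)) +
      ((c.2.val + 1 : ℕ) : ℤ)) 0 with h | h
    · exact Or.inl (alphaP_of_neg t c.1 _ h)
    · right
      change ((alphaP t c.1 (c.2.val + 1) _).totalDegree : ℤ) ≤ _
      have := (Int.le_toNat h).1 hle
      push_cast at this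
      exact this
  · have hsum : ∑ v : Fin t, ((t : ℤ) - 1 - v.val) = ∑ v ∈ Finset.range t, (v : ℤ) := by
      rw [Fin.sum_univ_eq_sum_range (fun v => (t : ℤ) - 1 - v), ← Finset.sum_range_reflect]
      refine Finset.sum_congr rfl fun v hv => ?_
      have := Finset.mem_range.1 hv
      omega
    have hgauss : (t * (t - 1) * a ^ 2 / 2 : ℕ) = (∑ v ∈ Finset.range t, v) * a ^ 2 := by
      rw [← Finset.sum_range_id_mul_two, mul_right_comm, Nat.mul_div_cancel _ two_pos]
    rw [hgauss, ← Finset.sum_add_distrib, Fintype.sum_prod_type]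
    push_cast
    rw [← hsum, Finset.sum_mul]
    refine Finset.sum_le_sum fun v _ => le_of_eq ?_
    rw [Finset.sum_congr rfl fun w _ => show _ = ((t : ℤ) - 1 - v.val) * a by ring]
    simp only [Finset.sum_const, Finset.card_univ, Fintype.card_fin, nsmul_eq_mul]
    ring
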